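/- Let w(v) = (1+|v|²)^{β/2} e^{ϖ|v|²} with β > 3 and 0 < ϖ ≤ 1/8, and let M(x,v) = ρ(x)(2πθ(x))^{−3/2} e^{−|v|²/(2θ(x))} be a local Maxwellian whose parameters satisfy 1/2 ≤ ρ(x) ≤ 2 and 1 ≤ θ(x) ≤ 2 for all x ∈ [0,1]. Then there is a constant C > 0, depending only on β and ϖ, such that for every measurable F : [0,1]×ℝ³ → ℝ with ‖wF/√μ‖_{L^∞} < ∞, the quadratic collision term satisfies ‖ν^{−1/2} Q(F(x,·), F(x,·))(v)/√M(x,v)‖_{L²((0,1)×ℝ³)} + ‖ν(v)^{−1} w(v) Q(F(x,·), F(x,·))(v)/√μ(v)‖_{L^∞((0,1)×ℝ³)} ≤ C ‖wF/√μ‖_{L^∞}², where Q acts in the velocity variable for each fixed x. -/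

import Mathlib

open Real MeasureTheory Set
open scoped RealInnerProductSpace ENNReal

noncomputable section

/-- Velocity space `ℝ³`. -/
abbrev V := EuclideanSpace ℝ (Fin 3)

/-- Surface measure on the unit sphere `S² ⊂ ℝ³`. -/
def sphμ : Measure (Metric.sphere (0:V) 1) := (volume : Measure V).toSphere

/-- The normalized global Maxwellian `μ(v) = (2π)^{−3/2} e^{−|v|²/2}`. -/
def gaussM (v : V) : ℝ := (2 * π) ^ (-(3:ℝ)/2) * Real.exp (-‖v‖ ^ 2 / 2)

/-- Post-collisional velocity `v' = v − ((v−u)·ω)ω`. -/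
def vPrime (v u : V) (ω : Metric.sphere (0:V) 1) : V := v - ⟪v - u, (ω : V)⟫ • (ω : V)

/-- Post-collisional velocity `u' = u + ((v−u)·ω)ω`. -/
def uPrime (v u : V) (ω : Metric.sphere (0:V) 1) : V := u + ⟪v - u, (ω : V)⟫ • (ω : V)

/-- The hard-sphere Boltzmann collision operator. -/
def Qop (F₁ F₂ : V → ℝ) (v : V) : ℝ :=
  ∫ u : V, ∫ ω : Metric.sphere (0:V) 1,
    |⟪v - u, (ω : V)⟫| * (F₁ (uPrime v u ω) * F₂ (vPrime v u ω) - F₁ u * F₂ v) ∂sphμ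

/-- The collision frequency `ν(v) = ∫∫ |(v−u)·ω| μ(u) dω du`. -/
def collFreq (v : V) : ℝ :=
  ∫ u : V, (∫ ω : Metric.sphere (0:V) 1, |⟪v - u, (ω : V)⟫| ∂sphμ) * gaussM u

/-- The weight function `w(v) = (1+|v|²)^{β/2} e^{ϖ|v|²}`. -/
def wt (β ϖ : ℝ) (v : V) : ℝ := (1 + ‖v‖ ^ 2) ^ (β / 2) * Real.exp (ϖ * ‖v‖ ^ 2)

/-- Local Maxwellian `M(x,v) = ρ(x)(2πθ(x))^{−3/2} e^{−|v|²/(2θ(x))}`. -/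
def Mlocal (ρ θ : ℝ → ℝ) (x : ℝ) (v : V) : ℝ :=
  ρ x * (2 * π * θ x) ^ (-(3:ℝ)/2) * Real.exp (-‖v‖ ^ 2 / (2 * θ x))

/-- The linearized operator `L_M f = −Q(M,f) − Q(f,M)` (acting in `v` for fixed `x`). -/
def LM (ρ θ : ℝ → ℝ) (x : ℝ) (f : V → ℝ) (v : V) : ℝ :=
  -(Qop (Mlocal ρ θ x) f v + Qop f (Mlocal ρ θ x) v)

/-- The macroscopic projection `P_M`: the orthogonal projection, w.r.t. the inner product
`⟨f,g⟩ = ∫ f g / M dv`, onto `span{M, v₁M, v₂M, v₃M, (|v|²−3θ(x))M}` (written explicitly). -/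
def PM (ρ θ : ℝ → ℝ) (x : ℝ) (f : V → ℝ) (v : V) : ℝ :=
  ((∫ u : V, f u) / ρ x) * Mlocal ρ θ x v +
  (∑ i : Fin 3, ((∫ u : V, u i * f u) / (ρ x * θ x)) * v i * Mlocal ρ θ x v) +
  ((∫ u : V, (‖u‖ ^ 2 - 3 * θ x) * f u) / (6 * ρ x * θ x ^ 2)) *
    (‖v‖ ^ 2 - 3 * θ x) * Mlocal ρ θ x v

/-- Diffuse reflection operator at the boundary point `x = 0` (where `n(0) = −1`). -/
def Pg0 (θ : ℝ → ℝ) (f : V → ℝ) (v : V) : ℝ :=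
  (2 * π * θ 0 ^ 2)⁻¹ * Real.exp (-‖v‖ ^ 2 / (2 * θ 0)) *
    ∫ u in {u : V | u 0 < 0}, f u * |u 0|

/-- Diffuse reflection operator at the boundary point `x = 1` (where `n(1) = 1`). -/
def Pg1 (θ : ℝ → ℝ) (f : V → ℝ) (v : V) : ℝ :=
  (2 * π * θ 1 ^ 2)⁻¹ * Real.exp (-‖v‖ ^ 2 / (2 * θ 1)) *
    ∫ u in {u : V | 0 < u 0}, f u * |u 0|

/-- `P_γ F` evaluated at a boundary point `x ∈ {0,1}`. -/
def Pgamma (θ : ℝ → ℝ) (F : ℝ → V → ℝ) (x : ℝ) (v : V) : ℝ :=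
  if x = 0 then Pg0 θ (F 0) v else Pg1 θ (F 1) v

/-- The product measure on `(0,1) × ℝ³`. -/
def Ωm : Measure (ℝ × V) := (volume.restrict (Ioo (0:ℝ) 1)).prod (volume : Measure V)

/-- `L^q` norm on `(0,1) × ℝ³`. -/
def bulkNorm (q : ℝ≥0∞) (f : ℝ → V → ℝ) : ℝ≥0∞ := eLpNorm (fun p => f p.1 p.2) q Ωm

/-- The boundary measure `|v₁| dv` on `ℝ³`. -/
def bdryMeas : Measure V := (volume : Measure V).withDensity (fun v => ENNReal.ofReal |v 0|)

/-- `L²` norm on the outgoing boundary `γ₊ = ({0}×{v₁<0}) ∪ ({1}×{v₁>0})`. -/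
def gammaPlusL2 (f : ℝ → V → ℝ) : ℝ≥0∞ :=
  ((eLpNorm (f 0) 2 (bdryMeas.restrict {v : V | v 0 < 0})) ^ 2 +
   (eLpNorm (f 1) 2 (bdryMeas.restrict {v : V | 0 < v 0})) ^ 2) ^ (1/2 : ℝ)

/-- `L²` norm on the incoming boundary `γ₋ = ({0}×{v₁>0}) ∪ ({1}×{v₁<0})`. -/
def gammaMinusL2 (f : ℝ → V → ℝ) : ℝ≥0∞ :=
  ((eLpNorm (f 0) 2 (bdryMeas.restrict {v : V | 0 < v 0})) ^ 2 +
   (eLpNorm (f 1) 2 (bdryMeas.restrict {v : V | v 0 < 0})) ^ 2) ^ (1/2 : ℝ)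

/-- `L^∞` norm on the incoming boundary `γ₋`. -/
def gammaMinusLinf (f : ℝ → V → ℝ) : ℝ≥0∞ :=
  max (eLpNorm (f 0) ⊤ (bdryMeas.restrict {v : V | 0 < v 0}))
      (eLpNorm (f 1) ⊤ (bdryMeas.restrict {v : V | v 0 < 0}))

/-- `‖∂ₓθ‖_{L^∞}` over `[0,1]`. -/
def thSup (θ : ℝ → ℝ) : ℝ := ⨆ x : Icc (0:ℝ) 1, |deriv θ (x : ℝ)|

/-- `F` solves the linear problem `ε v₁ ∂ₓF + L_M F = g` on `(0,1)×ℝ³`,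
with diffuse boundary condition `F = P_γ F + r` on `γ₋`. -/
def SolvesLin (ρ θ : ℝ → ℝ) (ε : ℝ) (F g r : ℝ → V → ℝ) : Prop :=
  (∀ v : V, ∀ x ∈ Ioo (0:ℝ) 1, DifferentiableAt ℝ (fun y => F y v) x) ∧
  (∀ x ∈ Ioo (0:ℝ) 1, ∀ v : V,
    ε * v 0 * deriv (fun y => F y v) x + LM ρ θ x (F x) v = g x v) ∧
  (∀ v : V, 0 < v 0 → F 0 v = Pgamma θ F 0 v + r 0 v) ∧
  (∀ v : V, v 0 < 0 → F 1 v = Pgamma θ F 1 v + r 1 v)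

/-- Smooth positive background `(ρ, θ)` on `[0,1]` with constant pressure `ρθ ≡ P₀`,
`θ ≥ 1`, and `C¹` distance to `(1,1)` at most `δ₀`. -/
def Background (ρ θ : ℝ → ℝ) (P₀ δ₀ : ℝ) : Prop :=
  ContDiff ℝ (⊤ : ℕ∞) ρ ∧ ContDiff ℝ (⊤ : ℕ∞) θ ∧
  (∀ x ∈ Icc (0:ℝ) 1, 0 < ρ x) ∧ (∀ x ∈ Icc (0:ℝ) 1, 1 ≤ θ x) ∧
  (∀ x ∈ Icc (0:ℝ) 1, ρ x * θ x = P₀) ∧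
  (∀ x ∈ Icc (0:ℝ) 1, |ρ x - 1| + |deriv ρ x| + |θ x - 1| + |deriv θ x| ≤ δ₀)

end

noncomputable section

instance sphFin : IsFiniteMeasure sphμ := by unfold sphμ; infer_instance

instance sphPos : sphμ.IsOpenPosMeasure := by unfold sphμ; infer_instance

lemma int_gauss {b : ℝ} (hb : 0 < b) : Integrable (fun v : V => Real.exp (-b * ‖v‖ ^ 2)) := by
  apply MeasureTheory.Integrable.of_integral_ne_zero
  rw [GaussianFourier.integral_rexp_neg_mul_sq_norm hb]
  have : 0 < π / b := by positivity
  positivity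

lemma poly_gauss {b : ℝ} (hb : 0 < b) (t : ℝ) :
    (1 + t) * Real.exp (-b * t ^ 2) ≤ (2 + 2 / b) * Real.exp (-(b / 2) * t ^ 2) := by
  have h1 : Real.exp (-b * t ^ 2) = Real.exp (-(b / 2) * t ^ 2) * Real.exp (-(b / 2 * t ^ 2)) := by
    rw [← Real.exp_add]; congr 1; ring
  have h2 : b / 2 * t ^ 2 + 1 ≤ Real.exp (b / 2 * t ^ 2) := Real.add_one_le_exp _
  have h3 : 1 + t ≤ (2 + 2 / b) * (b / 2 * t ^ 2 + 1) := by
    have : (2 + 2 / b) * (b / 2 * t ^ 2 + 1) = b * t ^ 2 + 2 + t ^ 2 + 2 / b := by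
      field_simp; ring
    rw [this]
    have : 0 < 2 / b := by positivity
    nlinarith [sq_nonneg (t - 1), sq_nonneg t, mul_nonneg hb.le (sq_nonneg t)]
  have h4 : (1 + t) * Real.exp (-(b / 2 * t ^ 2)) ≤ 2 + 2 / b := by
    rw [Real.exp_neg, ← div_eq_mul_inv, div_le_iff₀ (Real.exp_pos _)]
    refine h3.trans ?_
    gcongr
  rw [h1]
  nlinarith [Real.exp_pos (-(b / 2) * t ^ 2)]

lemma int_poly_gauss {b : ℝ} (hb : 0 < b) :
    Integrable (fun v : V => (1 + ‖v‖) * Real.exp (-b * ‖v‖ ^ 2)) := by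
  refine ((int_gauss (half_pos hb)).const_mul (2 + 2 / b)).mono' ?_ ?_
  · apply Continuous.aestronglyMeasurable; fun_prop
  · filter_upwards with v
    rw [Real.norm_of_nonneg (by positivity)]
    exact poly_gauss hb _

lemma inner_cont (z : V) :
    Continuous (fun ω : Metric.sphere (0:V) 1 => |⟪z, (ω : V)⟫|) := by fun_prop

lemma inner_le (z : V) (ω : Metric.sphere (0:V) 1) : |⟪z, (ω : V)⟫| ≤ ‖z‖ := by
  have h := abs_real_inner_le_norm z (ω : V)
  have : ‖(ω : V)‖ = 1 := by simp
  rwa [this, mul_one] at h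

lemma inner_int (z : V) :
    Integrable (fun ω : Metric.sphere (0:V) 1 => |⟪z, (ω : V)⟫|) sphμ := by
  refine (integrable_const ‖z‖).mono' (inner_cont z).aestronglyMeasurable ?_
  filter_upwards with ω
  simpa using inner_le z ω

/-- Spherical average of the hard-sphere kernel. -/
def sphS (z : V) : ℝ := ∫ ω : Metric.sphere (0:V) 1, |⟪z, (ω : V)⟫| ∂sphμ

lemma sphS_le (z : V) : sphS z ≤ sphμ.real univ * ‖z‖ := by
  unfold sphS
  refine (integral_mono (inner_int z) (integrable_const ‖z‖) (inner_le z)).trans ?_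
  simp

lemma sphS_nonneg (z : V) : 0 ≤ sphS z := integral_nonneg fun _ => abs_nonneg _

lemma sphS_pos {z : V} (hz : z ≠ 0) : 0 < sphS z := by
  have hn : 0 < ‖z‖ := norm_pos_iff.mpr hz
  refine integral_pos_of_integrable_nonneg_nonzero
    (x := (⟨‖z‖⁻¹ • z, by simp [norm_smul, hn.ne']⟩ : Metric.sphere (0:V) 1))
    (inner_cont z) (inner_int z) (fun _ => abs_nonneg _) ?_
  simp only [inner_smul_right, real_inner_self_eq_norm_sq]
  positivity

lemma sphS_add (y z : V) : sphS (y + z) ≤ sphS y + sphS z := by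
  unfold sphS
  rw [← integral_add (inner_int y) (inner_int z)]
  refine integral_mono (inner_int _) ((inner_int y).add (inner_int z)) fun ω => ?_
  simp only [inner_add_left]
  exact abs_add_le _ _

lemma sphS_smul (r : ℝ) (z : V) : sphS (r • z) = |r| * sphS z := by
  unfold sphS
  rw [← integral_const_mul]
  simp [inner_smul_left, abs_mul]

lemma sphS_cont : Continuous sphS := by
  unfold sphS
  have h := continuous_parametric_integral_of_continuous (μ := sphμ)
    (f := fun (z : V) (ω : Metric.sphere (0:V) 1) => |⟪z, (ω : V)⟫|)
    (by fun_prop) (s := univ) isCompact_univ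
  simpa using h

lemma sphS_lower : ∃ a > (0:ℝ), ∀ z : V, a * ‖z‖ ≤ sphS z := by
  obtain ⟨m, hm, hmin⟩ := (isCompact_sphere (0:V) 1).exists_isMinOn
    (NormedSpace.sphere_nonempty.mpr zero_le_one) sphS_cont.continuousOn
  have hm1 : ‖m‖ = 1 := by simpa using hm
  refine ⟨sphS m, sphS_pos (by rintro rfl; simp at hm1), fun z => ?_⟩
  by_cases hz : z = 0
  · subst hz; simpa using sphS_nonneg 0
  have hn : 0 < ‖z‖ := norm_pos_iff.mpr hz
  have h1 : sphS m ≤ sphS (‖z‖⁻¹ • z) := hmin (by simp [norm_smul, hn.ne'])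
  rw [sphS_smul, abs_of_pos (by positivity)] at h1
  calc sphS m * ‖z‖ ≤ ‖z‖⁻¹ * sphS z * ‖z‖ := by gcongr
    _ = sphS z := by field_simp

lemma gauss_const_pos : 0 < (2 * π) ^ (-(3:ℝ)/2) := by positivity

lemma gaussM_pos (v : V) : 0 < gaussM v := by unfold gaussM; positivity

lemma gaussM_eq (v : V) : gaussM v = (2 * π) ^ (-(3:ℝ)/2) * Real.exp (-(1/2) * ‖v‖ ^ 2) := by
  unfold gaussM; congr 2; ring

lemma gaussM_cont : Continuous gaussM := by unfold gaussM; fun_prop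

lemma int_gaussM : Integrable gaussM := by
  have := (int_gauss (b := 1/2) (by norm_num)).const_mul ((2 * π) ^ (-(3:ℝ)/2))
  refine this.congr ?_
  filter_upwards with v using (gaussM_eq v).symm

lemma int_poly_gaussM : Integrable (fun v : V => (1 + ‖v‖) * gaussM v) := by
  have := (int_poly_gauss (b := 1/2) (by norm_num)).const_mul ((2 * π) ^ (-(3:ℝ)/2))
  refine this.congr ?_
  filter_upwards with v
  rw [gaussM_eq v]; ring

lemma sub_norm_le (v u : V) : ‖v - u‖ ≤ (1 + ‖v‖) * (1 + ‖u‖) := by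
  have := norm_sub_le v u
  nlinarith [norm_nonneg v, norm_nonneg u, mul_nonneg (norm_nonneg v) (norm_nonneg u)]

lemma int_sphS_gauss (v : V) : Integrable (fun u : V => sphS (v - u) * gaussM u) := by
  refine (int_poly_gaussM.const_mul (sphμ.real univ * (1 + ‖v‖))).mono' ?_ ?_
  · exact ((sphS_cont.comp (by fun_prop)).mul gaussM_cont).aestronglyMeasurable
  · filter_upwards with u
    have hg := gaussM_pos u
    rw [Real.norm_of_nonneg (mul_nonneg (sphS_nonneg _) hg.le)]
    have h1 := sphS_le (v - u)
    have h2 := sub_norm_le v u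
    have h0 : 0 ≤ sphμ.real univ := measureReal_nonneg
    calc sphS (v - u) * gaussM u ≤ (sphμ.real univ * ((1 + ‖v‖) * (1 + ‖u‖))) * gaussM u := by
          gcongr
          exact h1.trans (by gcongr)
      _ = _ := by ring

lemma collFreq_eq (v : V) : collFreq v = ∫ u : V, sphS (v - u) * gaussM u := rfl

lemma collFreq_lower : ∃ c > (0:ℝ), ∀ v : V, c * (1 + ‖v‖) ≤ collFreq v := by
  obtain ⟨a, ha, hS⟩ := sphS_lower
  set m0 : ℝ := ∫ u : V, gaussM u with hm0
  have hm0p : 0 < m0 :=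
    integral_pos_of_integrable_nonneg_nonzero (x := 0) gaussM_cont int_gaussM
      (fun v => (gaussM_pos v).le) (gaussM_pos 0).ne'
  have hi1 : Integrable (fun u : V => ‖u‖ * gaussM u) := by
    refine (int_poly_gaussM.sub int_gaussM).congr ?_
    filter_upwards with v
    simp only [Pi.sub_apply]; ring
  set m1 : ℝ := ∫ u : V, ‖u‖ * gaussM u with hm1
  have hm1p : 0 < m1 := by
    obtain ⟨e, he⟩ := exists_ne (0:V)
    refine integral_pos_of_integrable_nonneg_nonzero (x := e)
      (continuous_norm.mul gaussM_cont) hi1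
      (fun v => mul_nonneg (norm_nonneg _) (gaussM_pos v).le) ?_
    exact mul_ne_zero (norm_ne_zero_iff.mpr he) (gaussM_pos e).ne'
  have key : ∀ v : V, a / 2 * (m0 * ‖v‖ + m1) ≤ collFreq v := by
    intro v
    have hneg : ∫ u : V, sphS (v + u) * gaussM u = collFreq v := by
      rw [collFreq_eq, ← integral_neg_eq_self (fun u : V => sphS (v - u) * gaussM u)]
      simp [gaussM]
    have hintp : Integrable (fun u : V => sphS (v + u) * gaussM u) := by
      have := (int_sphS_gauss v).comp_neg
      simpa [gaussM] using this
    have hsum : ∫ u : V, (a * (‖v‖ + ‖u‖)) * gaussM u ≤ collFreq v + collFreq v := by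
      nth_rewrite 2 [← hneg]
      rw [collFreq_eq, ← integral_add (int_sphS_gauss v) hintp]
      refine integral_mono ?_ ((int_sphS_gauss v).add hintp) fun u => ?_
      · refine ((int_gaussM.const_mul (a * ‖v‖)).add (hi1.const_mul a)).congr ?_
        filter_upwards with u
        simp only [Pi.add_apply]; ring
      · have hg := gaussM_pos u
        simp only
        rw [← add_mul]
        gcongr
        have h1 := hS (v - u)
        have h2 := hS (v + u)
        have h3 : ‖v‖ + ‖u‖ ≤ ‖v - u‖ + ‖v + u‖ := by
          have e1 : ‖(2:ℝ) • v‖ ≤ ‖v - u‖ + ‖v + u‖ := by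
            refine le_trans (le_of_eq ?_) (norm_add_le _ _)
            congr 1; rw [two_smul]; abel
          have e2 : ‖(2:ℝ) • u‖ ≤ ‖v + u‖ + ‖v - u‖ := by
            refine le_trans (le_of_eq ?_) (norm_sub_le _ _)
            congr 1; rw [two_smul]; abel
          rw [norm_smul] at e1 e2
          norm_num at e1 e2
          linarith
        nlinarith
    have heq : ∫ u : V, (a * (‖v‖ + ‖u‖)) * gaussM u = a * (m0 * ‖v‖ + m1) := by
      have : ∀ u : V, (a * (‖v‖ + ‖u‖)) * gaussM u =
          a * ‖v‖ * gaussM u + a * (‖u‖ * gaussM u) := fun u => by ring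
      simp_rw [this]
      rw [integral_add (int_gaussM.const_mul _) (hi1.const_mul a), integral_const_mul,
        integral_const_mul]
      ring
    rw [heq] at hsum
    linarith
  refine ⟨a / 2 * min m0 m1, by positivity, fun v => le_trans ?_ (key v)⟩
  have hn := norm_nonneg v
  rw [mul_assoc]
  gcongr
  nlinarith [min_le_left m0 m1, min_le_right m0 m1]

/-- The profile `√μ / w`. -/
def prof (β ϖ : ℝ) (v : V) : ℝ := Real.sqrt (gaussM v) / wt β ϖ v

/-- Normalization constant of `√μ`. -/
def sgc : ℝ := Real.sqrt ((2 * π) ^ (-(3:ℝ)/2))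

lemma sgc_pos : 0 < sgc := Real.sqrt_pos.mpr gauss_const_pos

lemma sqrt_gaussM (v : V) : Real.sqrt (gaussM v) = sgc * Real.exp (-(1/4) * ‖v‖ ^ 2) := by
  unfold gaussM sgc
  rw [Real.sqrt_mul gauss_const_pos.le, ← Real.exp_half]
  congr 2; ring

lemma wt_pos (β ϖ : ℝ) (v : V) : 0 < wt β ϖ v := by unfold wt; positivity

lemma prof_pos (β ϖ : ℝ) (v : V) : 0 < prof β ϖ v :=
  div_pos (Real.sqrt_pos.mpr (gaussM_pos v)) (wt_pos _ _ _)

lemma prof_eq (β ϖ : ℝ) (v : V) :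
    prof β ϖ v = sgc * Real.exp (-(1/4 + ϖ) * ‖v‖ ^ 2) * ((1 + ‖v‖ ^ 2) ^ (β / 2))⁻¹ := by
  unfold prof wt
  rw [sqrt_gaussM]
  have : Real.exp (-(1/4 + ϖ) * ‖v‖ ^ 2) =
      Real.exp (-(1/4) * ‖v‖ ^ 2) * (Real.exp (ϖ * ‖v‖ ^ 2))⁻¹ := by
    rw [← Real.exp_neg, ← Real.exp_add]; congr 1; ring
  rw [this, div_eq_mul_inv, mul_inv]; ring

lemma prof_mul_le {β ϖ : ℝ} (hβ : 0 < β) (hϖ : 0 < ϖ) (u v p q : V)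
    (h : ‖p‖ ^ 2 + ‖q‖ ^ 2 = ‖u‖ ^ 2 + ‖v‖ ^ 2) :
    prof β ϖ p * prof β ϖ q ≤ sgc * Real.exp (-(1/4) * ‖u‖ ^ 2) * prof β ϖ v := by
  simp only [prof_eq]
  have hs := sgc_pos
  have h1 : Real.exp (-(1/4 + ϖ) * ‖p‖ ^ 2) * Real.exp (-(1/4 + ϖ) * ‖q‖ ^ 2) ≤
      Real.exp (-(1/4) * ‖u‖ ^ 2) * Real.exp (-(1/4 + ϖ) * ‖v‖ ^ 2) := by
    rw [← Real.exp_add, ← Real.exp_add]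
    apply Real.exp_le_exp.mpr
    have e : -(1/4 + ϖ) * ‖p‖ ^ 2 + -(1/4 + ϖ) * ‖q‖ ^ 2
      = -(1/4 + ϖ) * (‖u‖ ^ 2 + ‖v‖ ^ 2) := by rw [← h]; ring
    rw [e]
    nlinarith [mul_nonneg hϖ.le (sq_nonneg ‖u‖)]
  have h2 : (1 + ‖v‖ ^ 2) ^ (β / 2) ≤ (1 + ‖p‖ ^ 2) ^ (β / 2) * (1 + ‖q‖ ^ 2) ^ (β / 2) := by
    rw [← Real.mul_rpow (by positivity) (by positivity)]
    apply Real.rpow_le_rpow (by positivity) _ (by positivity)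
    nlinarith [sq_nonneg ‖u‖, mul_nonneg (sq_nonneg ‖p‖) (sq_nonneg ‖q‖)]
  have h3 : ((1 + ‖p‖ ^ 2) ^ (β / 2))⁻¹ * ((1 + ‖q‖ ^ 2) ^ (β / 2))⁻¹ ≤
      ((1 + ‖v‖ ^ 2) ^ (β / 2))⁻¹ := by
    rw [← mul_inv]
    exact inv_anti₀ (by positivity) h2
  calc _ = sgc * sgc * ((Real.exp (-(1/4 + ϖ) * ‖p‖ ^ 2) * Real.exp (-(1/4 + ϖ) * ‖q‖ ^ 2)) *
        (((1 + ‖p‖ ^ 2) ^ (β / 2))⁻¹ * ((1 + ‖q‖ ^ 2) ^ (β / 2))⁻¹)) := by ring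
    _ ≤ sgc * sgc * ((Real.exp (-(1/4) * ‖u‖ ^ 2) * Real.exp (-(1/4 + ϖ) * ‖v‖ ^ 2)) *
        ((1 + ‖v‖ ^ 2) ^ (β / 2))⁻¹) := by gcongr
    _ = _ := by ring

lemma energy (v u : V) (ω : Metric.sphere (0:V) 1) :
    ‖uPrime v u ω‖ ^ 2 + ‖vPrime v u ω‖ ^ 2 = ‖u‖ ^ 2 + ‖v‖ ^ 2 := by
  unfold uPrime vPrime
  have hω : ‖(ω : V)‖ = 1 := by simp
  rw [norm_add_sq_real, norm_sub_sq_real, inner_smul_right, inner_smul_right, norm_smul, hω,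
    inner_sub_left, mul_one, Real.norm_eq_abs, sq_abs]
  ring

lemma Q_bound {β ϖ : ℝ} (hβ : 0 < β) (hϖ : 0 < ϖ) :
    ∃ K > (0:ℝ), ∀ (f : V → ℝ) (CF : ℝ), 0 ≤ CF → (∀ v, |f v| ≤ CF * prof β ϖ v) →
      ∀ v, |Qop f f v| ≤ K * CF ^ 2 * ((1 + ‖v‖) * prof β ϖ v) := by
  set A := sphμ.real univ with hA
  have hA0 : 0 ≤ A := measureReal_nonneg
  have hs := sgc_pos
  have hI := int_poly_gauss (b := 1/4) (by norm_num)
  set I : ℝ := ∫ u : V, (1 + ‖u‖) * Real.exp (-(1/4) * ‖u‖ ^ 2) with hIdef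
  have hI0 : 0 ≤ I := integral_nonneg fun u => by positivity
  refine ⟨2 * sgc * A * I + 1, by positivity, fun f CF hCF hf v => ?_⟩
  have hp := prof_pos β ϖ v
  have step : |Qop f f v| ≤ ∫ u : V, (2 * sgc * A * CF ^ 2 * ((1 + ‖v‖) * prof β ϖ v)) *
      ((1 + ‖u‖) * Real.exp (-(1/4) * ‖u‖ ^ 2)) := by
    unfold Qop
    rw [← Real.norm_eq_abs]
    refine norm_integral_le_of_norm_le (hI.const_mul _) ?_
    filter_upwards with u
    refine (norm_integral_le_of_norm_le_const
      (C := (1 + ‖v‖) * (1 + ‖u‖) *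
        (2 * CF ^ 2 * (sgc * Real.exp (-(1/4) * ‖u‖ ^ 2) * prof β ϖ v))) ?_).trans (le_of_eq ?_)
    · filter_upwards with ω
      rw [Real.norm_eq_abs, abs_mul, abs_abs]
      have h1 : |⟪v - u, (ω : V)⟫| ≤ (1 + ‖v‖) * (1 + ‖u‖) :=
        (inner_le _ ω).trans (sub_norm_le v u)
      have prod : ∀ p q : V, ‖p‖ ^ 2 + ‖q‖ ^ 2 = ‖u‖ ^ 2 + ‖v‖ ^ 2 →
          |f p * f q| ≤ CF ^ 2 * (sgc * Real.exp (-(1/4) * ‖u‖ ^ 2) * prof β ϖ v) := by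
        intro p q hpq
        rw [abs_mul]
        have hpp := prof_pos β ϖ p
        calc |f p| * |f q| ≤ (CF * prof β ϖ p) * (CF * prof β ϖ q) := by
              gcongr
              · exact hf p
              · exact hf q
          _ = CF ^ 2 * (prof β ϖ p * prof β ϖ q) := by ring
          _ ≤ _ := mul_le_mul_of_nonneg_left (prof_mul_le hβ hϖ u v p q hpq) (sq_nonneg _)
      have h2 := prod _ _ (energy v u ω)
      have h3 := prod u v rfl
      have h4 := abs_sub (f (uPrime v u ω) * f (vPrime v u ω)) (f u * f v)
      gcongr
      linarith
    · rw [← hA]; ring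
  rw [integral_const_mul, ← hIdef] at step
  refine step.trans ?_
  have : 0 ≤ CF ^ 2 * ((1 + ‖v‖) * prof β ϖ v) := by positivity
  nlinarith

lemma Mlocal_lower : ∃ c > (0:ℝ), ∀ (ρ θ : ℝ → ℝ) (x : ℝ), 1/2 ≤ ρ x → 1 ≤ θ x → θ x ≤ 2 →
    ∀ v : V, c * gaussM v ≤ Mlocal ρ θ x v := by
  refine ⟨1/2 * ((2 * π * 2) ^ (-(3:ℝ)/2) / (2 * π) ^ (-(3:ℝ)/2)), by positivity, ?_⟩
  intro ρ θ x hρ hθ1 hθ2 v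
  unfold gaussM Mlocal
  have hg := gauss_const_pos
  have hpi := Real.pi_pos
  have h1 : (2 * π * 2) ^ (-(3:ℝ)/2) ≤ (2 * π * θ x) ^ (-(3:ℝ)/2) :=
    Real.rpow_le_rpow_of_nonpos (by positivity) (by gcongr) (by norm_num)
  have h2 : Real.exp (-‖v‖ ^ 2 / 2) ≤ Real.exp (-‖v‖ ^ 2 / (2 * θ x)) := by
    apply Real.exp_le_exp.mpr
    rw [neg_div, neg_div, neg_le_neg_iff]
    gcongr
    linarith
  calc _ = 1/2 * (2 * π * 2) ^ (-(3:ℝ)/2) * Real.exp (-‖v‖ ^ 2 / 2) := by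
        field_simp
    _ ≤ _ := by gcongr

lemma wt_lower {β ϖ : ℝ} (hβ : 0 < β) (v : V) : Real.exp (ϖ * ‖v‖ ^ 2) ≤ wt β ϖ v := by
  unfold wt
  have : 1 ≤ (1 + ‖v‖ ^ 2) ^ (β / 2) :=
    Real.one_le_rpow (by nlinarith [sq_nonneg ‖v‖]) (by positivity)
  nlinarith [Real.exp_pos (ϖ * ‖v‖ ^ 2)]

lemma memLp_bound {ϖ : ℝ} (hϖ : 0 < ϖ) :
    MemLp (fun p : ℝ × V => (1 + ‖p.2‖) * Real.exp (-ϖ * ‖p.2‖ ^ 2)) 2 Ωm := by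
  have h : MemLp (fun v : V => (1 + ‖v‖) * Real.exp (-ϖ * ‖v‖ ^ 2)) 2 volume := by
    rw [memLp_two_iff_integrable_sq (Continuous.aestronglyMeasurable (by fun_prop))]
    refine ((int_gauss hϖ).const_mul ((2 + 2 / ϖ) ^ 2)).mono'
      (Continuous.aestronglyMeasurable (by fun_prop)) ?_
    filter_upwards with v
    rw [Real.norm_of_nonneg (by positivity)]
    have h1 := poly_gauss hϖ ‖v‖
    calc _ ≤ ((2 + 2 / ϖ) * Real.exp (-(ϖ / 2) * ‖v‖ ^ 2)) ^ 2 := by gcongr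
      _ = _ := by
        rw [mul_pow, ← Real.exp_nat_mul]; congr 2; push_cast; ring
  exact h.comp_snd _

/-- Quadratic collision estimate: `‖ν^{−1/2} Q(F,F)/√M‖_{L²} + ‖ν^{−1} w Q(F,F)/√μ‖_{L^∞}
≤ C ‖wF/√μ‖_{L^∞}²`, with `C` depending only on `β` and `ϖ`. -/
theorem stmt17 (β ϖ : ℝ) (hβ : 3 < β) (hϖ0 : 0 < ϖ) (hϖ : ϖ ≤ 1/8) :
    ∃ C > (0:ℝ), ∀ ρ θ : ℝ → ℝ,
      (∀ x ∈ Icc (0:ℝ) 1, 1/2 ≤ ρ x ∧ ρ x ≤ 2) →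
      (∀ x ∈ Icc (0:ℝ) 1, 1 ≤ θ x ∧ θ x ≤ 2) →
      ∀ F : ℝ → V → ℝ, ∀ CF : ℝ,
        Measurable (Function.uncurry F) →
        (∀ x ∈ Icc (0:ℝ) 1, ∀ v : V,
          |wt β ϖ v * F x v / Real.sqrt (gaussM v)| ≤ CF) →
        bulkNorm 2 (fun x v =>
            Qop (F x) (F x) v /
              (Real.sqrt (collFreq v) * Real.sqrt (Mlocal ρ θ x v))) +
          bulkNorm ⊤ (fun x v =>
            wt β ϖ v * Qop (F x) (F x) v / (collFreq v * Real.sqrt (gaussM v))) ≤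
        ENNReal.ofReal (C * CF ^ 2) := by
  have hβ0 : 0 < β := by linarith
  obtain ⟨K, hK, hQ⟩ := Q_bound hβ0 hϖ0
  obtain ⟨c, hc, hν⟩ := collFreq_lower
  obtain ⟨d, hd, hM⟩ := Mlocal_lower
  have hL := memLp_bound hϖ0
  set h : ℝ × V → ℝ := fun p => (1 + ‖p.2‖) * Real.exp (-ϖ * ‖p.2‖ ^ 2) with hh
  set N : ℝ := (eLpNorm h 2 Ωm).toReal with hN
  have hN0 : 0 ≤ N := ENNReal.toReal_nonneg
  have hNe : eLpNorm h 2 Ωm = ENNReal.ofReal N := (ENNReal.ofReal_toReal hL.2.ne).symm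
  set B : ℝ := K / (Real.sqrt c * Real.sqrt d) with hB
  have hB0 : 0 < B := by positivity
  refine ⟨B * N + K / c, by positivity, ?_⟩
  intro ρ θ hρ hθ F CF _ hF
  have hCF : 0 ≤ CF := (abs_nonneg _).trans (hF 0 (by simp) 0)
  have hFb : ∀ x ∈ Icc (0:ℝ) 1, ∀ v, |F x v| ≤ CF * prof β ϖ v := by
    intro x hx v
    have h1 := hF x hx v
    have hw := wt_pos β ϖ v
    have hg := Real.sqrt_pos.mpr (gaussM_pos v)
    rw [abs_div, abs_mul, abs_of_pos hw, abs_of_pos hg, div_le_iff₀ hg] at h1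
    unfold prof
    rw [← mul_div_assoc, le_div_iff₀ hw]
    linarith
  have hmem : ∀ᵐ p ∂Ωm, p.1 ∈ Icc (0:ℝ) 1 := by
    have h1 : ∀ᵐ x ∂(volume.restrict (Ioo (0:ℝ) 1)), x ∈ Icc (0:ℝ) 1 := by
      filter_upwards [ae_restrict_mem measurableSet_Ioo] with x hx using Ioo_subset_Icc_self hx
    exact Measure.quasiMeasurePreserving_fst.ae h1
  have e2 : bulkNorm 2 (fun x v => Qop (F x) (F x) v /
      (Real.sqrt (collFreq v) * Real.sqrt (Mlocal ρ θ x v))) ≤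
      ENNReal.ofReal (B * CF ^ 2 * N) := by
    unfold bulkNorm
    have hstep : eLpNorm (fun p : ℝ × V => Qop (F p.1) (F p.1) p.2 /
        (Real.sqrt (collFreq p.2) * Real.sqrt (Mlocal ρ θ p.1 p.2))) 2 Ωm ≤
        eLpNorm ((B * CF ^ 2) • h) 2 Ωm := by
      apply eLpNorm_mono_ae_real
      filter_upwards [hmem] with p hp
      obtain ⟨x, v⟩ := p
      simp only at hp
      simp only [hh, Pi.smul_apply, smul_eq_mul]
      have hq := hQ (F x) CF hCF (hFb x hp) v
      have hw := wt_pos β ϖ v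
      have hg := Real.sqrt_pos.mpr (gaussM_pos v)
      have hn := norm_nonneg v
      have h1 : Real.sqrt c ≤ Real.sqrt (collFreq v) :=
        Real.sqrt_le_sqrt (le_trans (by nlinarith) (hν v))
      have h2 : Real.sqrt d * Real.sqrt (gaussM v) ≤ Real.sqrt (Mlocal ρ θ x v) := by
        rw [← Real.sqrt_mul hd.le]
        exact Real.sqrt_le_sqrt (hM ρ θ x (hρ x hp).1 (hθ x hp).1 (hθ x hp).2 v)
      have hsc := Real.sqrt_pos.mpr hc
      have hsd := Real.sqrt_pos.mpr hd
      have h3 : Real.sqrt c * (Real.sqrt d * Real.sqrt (gaussM v)) ≤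
          Real.sqrt (collFreq v) * Real.sqrt (Mlocal ρ θ x v) := by gcongr
      have h4 : (wt β ϖ v)⁻¹ ≤ Real.exp (-ϖ * ‖v‖ ^ 2) := by
        rw [neg_mul, Real.exp_neg]
        exact inv_anti₀ (Real.exp_pos _) (wt_lower hβ0 v)
      rw [Real.norm_eq_abs, abs_div, abs_of_nonneg (a := _ * _) (by positivity)]
      calc _ ≤ (K * CF ^ 2 * ((1 + ‖v‖) * prof β ϖ v)) /
            (Real.sqrt c * (Real.sqrt d * Real.sqrt (gaussM v))) := by
            gcongr
            exact (abs_nonneg _).trans hq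
        _ = B * CF ^ 2 * ((1 + ‖v‖) * (wt β ϖ v)⁻¹) := by
            rw [hB]; unfold prof; field_simp
        _ ≤ _ := by gcongr
    refine hstep.trans ?_
    rw [eLpNorm_const_smul, hNe, Real.enorm_of_nonneg (by positivity),
      ← ENNReal.ofReal_mul (by positivity)]
  have ei : bulkNorm ⊤ (fun x v =>
      wt β ϖ v * Qop (F x) (F x) v / (collFreq v * Real.sqrt (gaussM v))) ≤
      ENNReal.ofReal (K / c * CF ^ 2) := by
    unfold bulkNorm
    rw [eLpNorm_exponent_top]
    apply eLpNormEssSup_le_of_ae_bound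
    filter_upwards [hmem] with p hp
    obtain ⟨x, v⟩ := p
    simp only at hp
    simp only
    have hq := hQ (F x) CF hCF (hFb x hp) v
    have hw := wt_pos β ϖ v
    have hg := Real.sqrt_pos.mpr (gaussM_pos v)
    have hn : 0 < 1 + ‖v‖ := by positivity
    have hν0 : 0 < collFreq v := lt_of_lt_of_le (by positivity) (hν v)
    rw [Real.norm_eq_abs, abs_div, abs_mul, abs_of_pos hw,
      abs_of_pos (a := _ * _) (by positivity)]
    calc _ ≤ wt β ϖ v * (K * CF ^ 2 * ((1 + ‖v‖) * prof β ϖ v)) /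
          (c * (1 + ‖v‖) * Real.sqrt (gaussM v)) := by
          have := prof_pos β ϖ v
          gcongr
          exact hν v
      _ = _ := by unfold prof; field_simp
  refine (add_le_add e2 ei).trans ?_
  rw [← ENNReal.ofReal_add (by positivity) (by positivity)]
  apply ENNReal.ofReal_le_ofReal
  apply le_of_eq; ring

end
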